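/- arXiv:1001.2939 — 3 statements merged into one kernel-verified Lean document; each statement's English description precedes it below -/
import Mathlib

section
/- For every (b, s) ∈ F(d), the function γ ↦ R2(b, s; γ) is continuous on ℝ. -/
open MeasureTheory Set

/-- Standard normal density. -/
noncomputable def phi (x : ℝ) : ℝ := (Real.sqrt (2 * Real.pi))⁻¹ * Real.exp (-(x ^ 2) / 2)

/-- Standard normal cumulative distribution function. -/
noncomputable def Phi (x : ℝ) : ℝ := ∫ u in Set.Iic x, phi u

/-- `Psi x y μ v = P(x ≤ Z ≤ y)` for `Z ~ N(μ, v)`. -/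
noncomputable def Psi (x y μ v : ℝ) : ℝ :=
  ∫ z in Set.Icc x y, (Real.sqrt (2 * Real.pi * v))⁻¹ * Real.exp (-((z - μ) ^ 2) / (2 * v))

/-- Density of `W = √(Q/m)` where `Q ~ χ²_m`. -/
noncomputable def fW (m : ℕ) (w : ℝ) : ℝ :=
  if 0 < w then
    (2 * ((m : ℝ) / 2) ^ ((m : ℝ) / 2) / Real.Gamma ((m : ℝ) / 2)) * w ^ ((m : ℝ) - 1) *
      Real.exp (-(m : ℝ) * w ^ 2 / 2)
  else 0

/-- `E(W) = ∫₀^∞ w f_W(w) dw`. -/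
noncomputable def EW (m : ℕ) : ℝ := ∫ w in Set.Ioi (0 : ℝ), w * fW m w

/-- The class `F(d)` of pairs `(b, s)`: `b : ℝ → ℝ` odd and bounded, `s : [0,∞) → (0,∞)`
bounded, both continuous except possibly at finitely many points, with `b(x) = 0` for
`|x| ≥ d` and `s(x) = t` for `x ≥ d`. -/
structure MemF (d t : ℝ) (b s : ℝ → ℝ) : Prop where
  b_odd : ∀ x, b (-x) = -b x
  b_bdd : ∃ M : ℝ, ∀ x, |b x| ≤ M
  s_pos : ∀ x, 0 ≤ x → 0 < s x
  s_bdd : ∃ M : ℝ, ∀ x, 0 ≤ x → s x ≤ M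
  b_cont : ∃ S : Finset ℝ, ∀ x ∉ S, ContinuousAt b x
  s_cont : ∃ S : Finset ℝ, ∀ x, 0 ≤ x → x ∉ S → ContinuousAt s x
  b_zero : ∀ x, d ≤ |x| → b x = 0
  s_eq_t : ∀ x, d ≤ x → s x = t

/-- Scaled expected-length excess `R1(b,s;γ)` (it depends on `(b,s)` only through `s`). -/
noncomputable def R1 (m : ℕ) (t d : ℝ) (s : ℝ → ℝ) (γ : ℝ) : ℝ :=
  (1 / (t * EW m)) *
    ∫ w in Set.Ioi (0 : ℝ),
      (∫ x in (-d)..d, (s |x| - t) * phi (w * x - γ)) * (w ^ 2 * fW m w)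

/-- `k†(h, w, γ) = Ψ(−tw, tw; ρ(h−γ), 1−ρ²)`. -/
noncomputable def kdag (t ρ h w γ : ℝ) : ℝ :=
  Psi (-(t * w)) (t * w) (ρ * (h - γ)) (1 - ρ ^ 2)

/-- `k(h, w, γ) = Ψ(b(h/w)w − s(|h|/w)w, b(h/w)w + s(|h|/w)w; ρ(h−γ), 1−ρ²)`. -/
noncomputable def kfun (b s : ℝ → ℝ) (ρ h w γ : ℝ) : ℝ :=
  Psi (b (h / w) * w - s (|h| / w) * w) (b (h / w) * w + s (|h| / w) * w)
    (ρ * (h - γ)) (1 - ρ ^ 2)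

/-- Minus the coverage-probability excess, `R2(b,s;γ)`. -/
noncomputable def R2 (m : ℕ) (t d ρ : ℝ) (b s : ℝ → ℝ) (γ : ℝ) : ℝ :=
  -∫ w in Set.Ioi (0 : ℝ),
      (∫ x in (-d)..d, (kfun b s ρ (w * x) w γ - kdag t ρ (w * x) w γ) * phi (w * x - γ)) *
        (w * fW m w)

/-- A real function that is continuous off a finite set is measurable. -/
lemma measurable_of_continuousAt_off_finset {f : ℝ → ℝ} (S : Finset ℝ)
    (hf : ∀ x ∉ S, ContinuousAt f x) : Measurable f := by
  refine measurable_of_measurable_on_compl_finite (S : Set ℝ) S.finite_toSet ?_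
  refine Continuous.measurable ?_
  rw [← continuousOn_iff_continuous_domRestrict]
  exact fun x hx => (hf x (by simpa using hx)).continuousWithinAt

lemma MemF.measurable_b {d t : ℝ} {b s : ℝ → ℝ} (h : MemF d t b s) : Measurable b := by
  obtain ⟨S, hS⟩ := h.b_cont
  exact measurable_of_continuousAt_off_finset S hS

lemma MemF.measurable_s_abs {d t : ℝ} {b s : ℝ → ℝ} (h : MemF d t b s) :
    Measurable fun x => s |x| := by
  obtain ⟨S, hS⟩ := h.s_cont
  refine measurable_of_continuousAt_off_finset (S ∪ S.image fun x => -x) fun x hx => ?_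
  have hxS : |x| ∉ S := by
    simp only [Finset.mem_union, Finset.mem_image, not_or, not_exists, not_and] at hx
    intro hmem
    rcases abs_choice x with h' | h'
    · exact hx.1 (h' ▸ hmem)
    · exact hx.2 _ hmem (by rw [h']; ring)
  exact (hS |x| (abs_nonneg x) hxS).comp continuous_abs.continuousAt

lemma Psi_eq_setIntegral_gaussianPDFReal (x y μ : ℝ) (v : NNReal) :
    Psi x y μ v = ∫ z in Icc x y, ProbabilityTheory.gaussianPDFReal μ v z := rfl

lemma Psi_nonneg (x y μ : ℝ) (v : NNReal) : 0 ≤ Psi x y μ v := by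
  rw [Psi_eq_setIntegral_gaussianPDFReal]
  exact integral_nonneg fun z => ProbabilityTheory.gaussianPDFReal_nonneg μ v z

lemma Psi_le_one (x y μ : ℝ) {v : NNReal} (hv : v ≠ 0) : Psi x y μ v ≤ 1 := by
  rw [Psi_eq_setIntegral_gaussianPDFReal, ← ProbabilityTheory.integral_gaussianPDFReal_eq_one μ hv]
  exact setIntegral_le_integral (ProbabilityTheory.integrable_gaussianPDFReal μ v)
    (Filter.Eventually.of_forall fun z => ProbabilityTheory.gaussianPDFReal_nonneg μ v z)

lemma Psi_eq_sub (x y μ : ℝ) (v : NNReal) :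
    Psi x y μ v = (∫ z in (0 : ℝ)..(max x y - μ), ProbabilityTheory.gaussianPDFReal 0 v z) -
      ∫ z in (0 : ℝ)..(x - μ), ProbabilityTheory.gaussianPDFReal 0 v z := by
  have hint : ∀ a b : ℝ, IntervalIntegrable (ProbabilityTheory.gaussianPDFReal 0 v) volume a b :=
    fun a b => (ProbabilityTheory.integrable_gaussianPDFReal 0 v).intervalIntegrable
  rw [intervalIntegral.integral_interval_sub_left (hint _ _) (hint _ _),
    ← intervalIntegral.integral_comp_sub_right
      (fun z => ProbabilityTheory.gaussianPDFReal 0 v z) μ,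
    Psi_eq_setIntegral_gaussianPDFReal, integral_Icc_eq_integral_Ioc]
  have hfun : ∀ z, ProbabilityTheory.gaussianPDFReal 0 v (z - μ) =
      ProbabilityTheory.gaussianPDFReal μ v z := fun z => by
    simp [ProbabilityTheory.gaussianPDFReal]
  simp only [hfun]
  rcases le_total x y with h | h
  · rw [max_eq_right h, intervalIntegral.integral_of_le h]
  · rw [max_eq_left h, intervalIntegral.integral_same, Ioc_eq_empty (not_lt.2 h)]
    simp

lemma continuous_Psi (v : NNReal) :
    Continuous fun p : ℝ × ℝ × ℝ => Psi p.1 p.2.1 p.2.2 v := by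
  simp only [Psi_eq_sub]
  have hG : Continuous fun a : ℝ =>
      ∫ z in (0 : ℝ)..a, ProbabilityTheory.gaussianPDFReal 0 v z :=
    intervalIntegral.continuous_primitive
      (fun a b => (ProbabilityTheory.integrable_gaussianPDFReal 0 v).intervalIntegrable) 0
  exact (hG.comp (by fun_prop : Continuous fun p : ℝ × ℝ × ℝ => max p.1 p.2.1 - p.2.2)).sub
    (hG.comp (by fun_prop : Continuous fun p : ℝ × ℝ × ℝ => p.1 - p.2.2))

lemma continuous_phi : Continuous phi := by
  unfold phi
  fun_prop

lemma abs_phi_le (x : ℝ) : |phi x| ≤ (Real.sqrt (2 * Real.pi))⁻¹ := by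
  unfold phi
  rw [abs_of_nonneg (by positivity)]
  refine mul_le_of_le_one_right (by positivity) (Real.exp_le_one_iff.2 ?_)
  nlinarith [sq_nonneg x]

lemma integrableOn_mul_fW {m : ℕ} (hm : 0 < m) :
    IntegrableOn (fun w => w * fW m w) (Ioi 0) := by
  have hm' : (0 : ℝ) < m := by exact_mod_cast hm
  have h := (integrableOn_rpow_mul_exp_neg_mul_sq (b := (m : ℝ) / 2) (by positivity)
    (s := (m : ℝ)) (by linarith)).const_mul
      (2 * ((m : ℝ) / 2) ^ ((m : ℝ) / 2) / Real.Gamma ((m : ℝ) / 2))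
  refine IntegrableOn.congr_fun h (fun w hw => ?_) measurableSet_Ioi
  have hw' : 0 < w := hw
  simp only [fW, if_pos hw']
  have h1 : w ^ (m : ℝ) = w * w ^ ((m : ℝ) - 1) := by
    rw [Real.rpow_sub_one hw'.ne']
    field_simp
  rw [h1, show -(m : ℝ) * w ^ 2 / 2 = -((m : ℝ) / 2) * w ^ 2 by ring]
  ring

section Integrand

variable {d t ρ : ℝ} {b s : ℝ → ℝ}

lemma measurable_kfun (hbs : MemF d t b s) (v : NNReal) (hv : (v : ℝ) = 1 - ρ ^ 2) (γ : ℝ) :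
    Measurable fun p : ℝ × ℝ => kfun b s ρ p.1 |p.2| γ := by
  have hb := hbs.measurable_b
  have hs := hbs.measurable_s_abs
  have hs' : ∀ p : ℝ × ℝ, s (|p.1| / |p.2|) = s |p.1 / p.2| := fun p => by rw [abs_div]
  simp only [kfun, ← hv, hs']
  have h1 : Measurable fun p : ℝ × ℝ => b (p.1 / |p.2|) := hb.comp (by fun_prop)
  have h2 : Measurable fun p : ℝ × ℝ => s |p.1 / p.2| :=
    hs.comp (by fun_prop : Measurable fun p : ℝ × ℝ => p.1 / p.2)
  have hw : Measurable fun p : ℝ × ℝ => |p.2| := by fun_prop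
  exact (continuous_Psi v).measurable.comp
    (((h1.mul hw).sub (h2.mul hw)).prodMk (((h1.mul hw).add (h2.mul hw)).prodMk
      (by fun_prop : Measurable fun p : ℝ × ℝ => ρ * (p.1 - γ))))

lemma continuous_kfun (v : NNReal) (hv : (v : ℝ) = 1 - ρ ^ 2) (h w : ℝ) :
    Continuous fun γ => kfun b s ρ h w γ := by
  simp only [kfun, ← hv]
  exact (continuous_Psi v).comp (by fun_prop : Continuous fun γ =>
    (b (h / w) * w - s (|h| / w) * w, b (h / w) * w + s (|h| / w) * w, ρ * (h - γ)))

lemma continuous_kdag (v : NNReal) (hv : (v : ℝ) = 1 - ρ ^ 2) :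
    Continuous fun p : ℝ × ℝ × ℝ => kdag t ρ p.1 p.2.1 p.2.2 := by
  simp only [kdag, ← hv]
  exact (continuous_Psi v).comp (by fun_prop : Continuous fun p : ℝ × ℝ × ℝ =>
    (-(t * p.2.1), t * p.2.1, ρ * (p.1 - p.2.2)))

lemma abs_kfun_sub_kdag_le_one (v : NNReal) (hv : (v : ℝ) = 1 - ρ ^ 2) (hv0 : v ≠ 0)
    (h w γ : ℝ) : |kfun b s ρ h w γ - kdag t ρ h w γ| ≤ 1 := by
  simp only [kfun, kdag, ← hv]
  exact abs_sub_le_of_nonneg_of_le (Psi_nonneg _ _ _ v) (Psi_le_one _ _ _ hv0)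
    (Psi_nonneg _ _ _ v) (Psi_le_one _ _ _ hv0)

end Integrand

/-- For every `(b,s) ∈ F(d)`, `γ ↦ R2(b,s;γ)` is continuous on `ℝ`. -/
theorem R2_continuous
    (m : ℕ) (hm : 0 < m) (t d ρ : ℝ) (ht : 0 < t) (hd : 0 < d)
    (hρ₁ : -1 < ρ) (hρ₂ : ρ < 1)
    (b s : ℝ → ℝ) (hbs : MemF d t b s) :
    Continuous (fun γ : ℝ => R2 m t d ρ b s γ) := by
  have hpos : 0 < 1 - ρ ^ 2 := by nlinarith
  obtain ⟨v, hv⟩ : ∃ v : NNReal, (v : ℝ) = 1 - ρ ^ 2 := ⟨⟨1 - ρ ^ 2, hpos.le⟩, rfl⟩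
  have hv0 : v ≠ 0 := by
    rintro rfl
    simp only [NNReal.coe_zero] at hv
    linarith
  set C := (Real.sqrt (2 * Real.pi))⁻¹
  have hbound : ∀ x w γ : ℝ,
      ‖(kfun b s ρ (w * x) w γ - kdag t ρ (w * x) w γ) * phi (w * x - γ)‖ ≤ C := by
    intro x w γ
    rw [norm_mul, Real.norm_eq_abs, Real.norm_eq_abs, ← one_mul C]
    exact mul_le_mul (abs_kfun_sub_kdag_le_one v hv hv0 _ _ _) (abs_phi_le _) (abs_nonneg _)
      zero_le_one
  have hmeas : ∀ γ : ℝ, Measurable fun p : ℝ × ℝ =>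
      (kfun b s ρ (|p.1| * p.2) |p.1| γ - kdag t ρ (|p.1| * p.2) |p.1| γ) *
        phi (|p.1| * p.2 - γ) := by
    intro γ
    have h1 : Measurable fun p : ℝ × ℝ => kfun b s ρ (|p.1| * p.2) |p.1| γ :=
      (measurable_kfun hbs v hv γ).comp
        (by fun_prop : Measurable fun p : ℝ × ℝ => (|p.1| * p.2, p.1))
    have h2 : Measurable fun p : ℝ × ℝ => kdag t ρ (|p.1| * p.2) |p.1| γ :=
      (continuous_kdag v hv).measurable.comp
        (by fun_prop : Measurable fun p : ℝ × ℝ => (|p.1| * p.2, |p.1|, γ))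
    exact (h1.sub h2).mul (continuous_phi.measurable.comp (by fun_prop))
  unfold R2
  refine Continuous.neg ?_
  refine continuous_of_dominated
    (bound := fun w => C * |d - -d| * ‖w * fW m w‖) (fun γ => ?_) (fun γ => ?_) ?_ ?_
  · refine AEStronglyMeasurable.mul ?_ (integrableOn_mul_fW hm).aestronglyMeasurable
    have h := (hmeas γ).stronglyMeasurable.integral_prod_right'
      (ν := volume.restrict (Ioc (-d) d))
    refine h.aestronglyMeasurable.congr ?_
    filter_upwards [ae_restrict_mem measurableSet_Ioi] with w hw
    rw [intervalIntegral.integral_of_le (by linarith), abs_of_pos (show 0 < w from hw)]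
  · refine Filter.Eventually.of_forall fun w => ?_
    rw [norm_mul]
    gcongr
    exact intervalIntegral.norm_integral_le_of_norm_le_const fun x _ => hbound x w γ
  · exact (integrableOn_mul_fW hm).norm.const_mul _
  · filter_upwards [ae_restrict_mem measurableSet_Ioi] with w hw
    refine Continuous.mul ?_ continuous_const
    refine intervalIntegral.continuous_of_dominated_interval (bound := fun _ => C)
      (fun γ => ?_) (fun γ => ?_) (by simp) ?_
    · have h := (hmeas γ).comp (measurable_prodMk_left (x := w))
      simp only [Function.comp_def, abs_of_pos (show 0 < w from hw)] at h
      exact h.aestronglyMeasurable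
    · exact Filter.Eventually.of_forall fun x _ => hbound x w γ
    · refine Filter.Eventually.of_forall fun x _ => ?_
      exact ((continuous_kfun v hv _ _).sub ((continuous_kdag v hv).comp
        (by fun_prop : Continuous fun γ : ℝ => (w * x, w, γ)))).mul
          (continuous_phi.comp (by fun_prop))
end

section
/- Let s > 0. Then for every real b, ∫₀^∞ (Φ(b w + s w) − Φ(b w − s w)) w f_W(w) dw ≤ ∫₀^∞ (Φ(s w) − Φ(−s w)) w f_W(w) dw, with strict inequality whenever b ≠ 0. -/
open MeasureTheory Set

lemma phi_pos (x : ℝ) : 0 < phi x := by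
  unfold phi
  positivity

lemma integrable_phi : Integrable phi := by
  have h := (integrable_exp_neg_mul_sq (b := 1 / 2) (by norm_num)).const_mul
    (Real.sqrt (2 * Real.pi))⁻¹
  refine h.congr (Filter.Eventually.of_forall fun x => ?_)
  simp only [phi]
  congr 2
  ring

lemma Phi_sub_Phi (x y : ℝ) : Phi y - Phi x = ∫ u in x..y, phi u :=
  intervalIntegral.integral_Iic_sub_Iic integrable_phi.integrableOn integrable_phi.integrableOn

lemma hasDerivAt_Phi (x : ℝ) : HasDerivAt Phi (phi x) x := by
  have h : HasDerivAt (fun y => Phi 0 + ∫ u in (0 : ℝ)..y, phi u) (phi x) x :=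
    (continuous_phi.integral_hasStrictDerivAt 0 x).hasDerivAt.const_add (Phi 0)
  refine h.congr_of_eventuallyEq (Filter.Eventually.of_forall fun y => ?_)
  simp only [← Phi_sub_Phi]
  ring

lemma continuous_Phi : Continuous Phi :=
  continuous_iff_continuousAt.2 fun x => (hasDerivAt_Phi x).continuousAt

lemma Phi_nonneg (x : ℝ) : 0 ≤ Phi x :=
  setIntegral_nonneg measurableSet_Iic fun u _ => (phi_pos u).le

lemma Phi_le_integral_phi (x : ℝ) : Phi x ≤ ∫ u, phi u :=
  setIntegral_le_integral integrable_phi (Filter.Eventually.of_forall fun u => (phi_pos u).le)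

lemma abs_Phi_sub_Phi_le (x y : ℝ) : |Phi x - Phi y| ≤ ∫ u, phi u := by
  rw [abs_le]
  constructor <;> linarith [Phi_nonneg x, Phi_nonneg y, Phi_le_integral_phi x,
    Phi_le_integral_phi y]

lemma phi_lt_phi_of_sq_lt_sq {x y : ℝ} (h : x ^ 2 < y ^ 2) : phi y < phi x := by
  unfold phi
  have hc : 0 < (Real.sqrt (2 * Real.pi))⁻¹ := by positivity
  exact mul_lt_mul_of_pos_left (Real.exp_lt_exp.2 (by linarith)) hc

lemma hasDerivAt_Phi_window (c a : ℝ) :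
    HasDerivAt (fun x => Phi (x + c) - Phi (x - c)) (phi (a + c) - phi (a - c)) a :=
  ((hasDerivAt_Phi (a + c)).comp_add_const a c).sub ((hasDerivAt_Phi (a - c)).comp_sub_const a c)

/-- A window of fixed half-width has the largest standard normal probability when it is centred at
the origin, and only then. -/
lemma Phi_window_lt {a c : ℝ} (hc : 0 < c) (ha : a ≠ 0) :
    Phi (a + c) - Phi (a - c) < Phi c - Phi (-c) := by
  have hcont : Continuous fun x => Phi (x + c) - Phi (x - c) :=
    continuous_iff_continuousAt.2 fun x => (hasDerivAt_Phi_window c x).continuousAt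
  rcases ha.lt_or_gt with h | h
  · have hmono : StrictMonoOn (fun x => Phi (x + c) - Phi (x - c)) (Iic 0) := by
      refine strictMonoOn_of_deriv_pos (convex_Iic 0) hcont.continuousOn fun x hx => ?_
      rw [interior_Iic, mem_Iio] at hx
      rw [(hasDerivAt_Phi_window c x).deriv, sub_pos]
      exact phi_lt_phi_of_sq_lt_sq (by nlinarith)
    simpa using hmono (mem_Iic.2 h.le) (mem_Iic.2 le_rfl) h
  · have hanti : StrictAntiOn (fun x => Phi (x + c) - Phi (x - c)) (Ici 0) := by
      refine strictAntiOn_of_deriv_neg (convex_Ici 0) hcont.continuousOn fun x hx => ?_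
      rw [interior_Ici, mem_Ioi] at hx
      rw [(hasDerivAt_Phi_window c x).deriv, sub_neg]
      exact phi_lt_phi_of_sq_lt_sq (by nlinarith)
    simpa using hanti (mem_Ici.2 le_rfl) (mem_Ici.2 h.le) h

lemma fW_pos {m : ℕ} (hm : 0 < m) {w : ℝ} (hw : 0 < w) : 0 < fW m w := by
  have hm' : (0 : ℝ) < m := by exact_mod_cast hm
  have hG : 0 < Real.Gamma ((m : ℝ) / 2) := Real.Gamma_pos_of_pos (by positivity)
  rw [fW, if_pos hw]
  positivity

lemma integrableOn_Phi_sub_Phi_mul {m : ℕ} (hm : 0 < m) {u v : ℝ → ℝ} (hu : Continuous u)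
    (hv : Continuous v) :
    IntegrableOn (fun w => (Phi (u w) - Phi (v w)) * (w * fW m w)) (Ioi 0) := by
  refine Integrable.bdd_mul (integrableOn_mul_fW hm) (c := ∫ x, phi x) ?_ ?_
  · exact ((continuous_Phi.comp hu).sub (continuous_Phi.comp hv)).aestronglyMeasurable
  · exact Filter.Eventually.of_forall fun w => abs_Phi_sub_Phi_le _ _

lemma setIntegral_Ioi_lt_of_lt {f g : ℝ → ℝ} (hf : IntegrableOn f (Ioi 0))
    (hg : IntegrableOn g (Ioi 0)) (h : ∀ w, 0 < w → f w < g w) :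
    ∫ w in Ioi (0 : ℝ), f w < ∫ w in Ioi (0 : ℝ), g w := by
  rw [← sub_pos, ← integral_sub hg hf, setIntegral_pos_iff_support_of_nonneg_ae]
  · have hsub : Ioi (0 : ℝ) ⊆ (Function.support fun w => g w - f w) ∩ Ioi 0 :=
      fun w hw => ⟨(sub_pos.2 (h w hw)).ne', hw⟩
    exact lt_of_lt_of_le (by simp) (measure_mono hsub)
  · exact (ae_restrict_mem measurableSet_Ioi).mono fun w hw => (sub_pos.2 (h w hw)).le
  · exact hg.sub hf

/-- For fixed `s > 0`,
`∫₀^∞ (Φ(bw+sw) − Φ(bw−sw)) w f_W(w) dw ≤ ∫₀^∞ (Φ(sw) − Φ(−sw)) w f_W(w) dw`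
for every `b`, with strict inequality whenever `b ≠ 0`. -/
theorem integral_Phi_window_max_at_zero
    (m : ℕ) (hm : 0 < m) (s : ℝ) (hs : 0 < s) (b : ℝ) :
    (∫ w in Set.Ioi (0 : ℝ), (Phi (b * w + s * w) - Phi (b * w - s * w)) * (w * fW m w)) ≤
        (∫ w in Set.Ioi (0 : ℝ), (Phi (s * w) - Phi (-(s * w))) * (w * fW m w)) ∧
      (b ≠ 0 →
        (∫ w in Set.Ioi (0 : ℝ), (Phi (b * w + s * w) - Phi (b * w - s * w)) * (w * fW m w)) <
          (∫ w in Set.Ioi (0 : ℝ), (Phi (s * w) - Phi (-(s * w))) * (w * fW m w))) := by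
  have hlt : b ≠ 0 →
      (∫ w in Set.Ioi (0 : ℝ), (Phi (b * w + s * w) - Phi (b * w - s * w)) * (w * fW m w)) <
        (∫ w in Set.Ioi (0 : ℝ), (Phi (s * w) - Phi (-(s * w))) * (w * fW m w)) := fun hb =>
    setIntegral_Ioi_lt_of_lt (integrableOn_Phi_sub_Phi_mul hm (by fun_prop) (by fun_prop))
      (integrableOn_Phi_sub_Phi_mul hm (by fun_prop) (by fun_prop)) fun w hw =>
        mul_lt_mul_of_pos_right (Phi_window_lt (mul_pos hs hw) (mul_ne_zero hb hw.ne'))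
          (mul_pos hw (fW_pos hm hw))
  refine ⟨?_, hlt⟩
  rcases eq_or_ne b 0 with rfl | hb
  · simp
  · exact (hlt hb).le
end

section
/- Fix t > 0 and set ℓ = 2 ∫₀^∞ φ(t w) w² f_W(w) dw. Define r(s) = ℓ s − 2 ∫₀^∞ Φ(s w) w f_W(w) dw for s > 0. Then r attains its global minimum on (0, ∞) uniquely at s = t; that is, r(s) > r(t) for every s > 0 with s ≠ t. -/
open MeasureTheory Set

/-- The function `r(s) = ℓ s − 2 ∫₀^∞ Φ(sw) w f_W(w) dw`, where
`ℓ = 2 ∫₀^∞ φ(tw) w² f_W(w) dw`. -/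
noncomputable def rfun (m : ℕ) (t s : ℝ) : ℝ :=
  (2 * ∫ w in Set.Ioi (0 : ℝ), phi (t * w) * (w ^ 2 * fW m w)) * s -
    2 * ∫ w in Set.Ioi (0 : ℝ), Phi (s * w) * (w * fW m w)

lemma phi_le_phi_zero (x : ℝ) : phi x ≤ phi 0 := by
  unfold phi
  refine mul_le_mul_of_nonneg_left (Real.exp_le_exp.2 ?_) (by positivity)
  nlinarith [sq_nonneg x]

/-- The normal density is strictly decreasing on `[0, ∞)`. -/
lemma strictAntiOn_phi : StrictAntiOn phi (Ici 0) := by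
  intro a ha b _ hab
  have ha' : 0 ≤ a := ha
  unfold phi
  have : 0 < (Real.sqrt (2 * Real.pi))⁻¹ := by positivity
  gcongr

lemma abs_Phi_le (x : ℝ) : |Phi x| ≤ ∫ u, phi u := by
  unfold Phi
  rw [abs_of_nonneg (integral_nonneg fun u => (phi_pos u).le)]
  exact setIntegral_le_integral integrable_phi
    (Filter.Eventually.of_forall fun u => (phi_pos u).le)

/-- Strict concavity of `Phi` on the positive half-line, in tangent-line form. -/
lemma Phi_sub_Phi_lt {a b : ℝ} (ha : 0 < a) (hb : 0 < b) (hab : b ≠ a) :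
    Phi b - Phi a < phi a * (b - a) := by
  rcases lt_or_gt_of_ne hab with h | h
  · obtain ⟨c, hc, hslope⟩ := exists_hasDerivAt_eq_slope Phi phi h
      continuous_Phi.continuousOn fun x _ => hasDerivAt_Phi x
    have hlt := strictAntiOn_phi (hb.trans hc.1).le ha.le hc.2
    rw [eq_div_iff (sub_ne_zero.2 h.ne')] at hslope
    nlinarith
  · obtain ⟨c, hc, hslope⟩ := exists_hasDerivAt_eq_slope Phi phi h
      continuous_Phi.continuousOn fun x _ => hasDerivAt_Phi x
    have hlt := strictAntiOn_phi ha.le (ha.trans hc.1).le hc.1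
    rw [eq_div_iff (sub_ne_zero.2 h.ne')] at hslope
    nlinarith

/-- All moments of `W` are finite. -/
lemma integrableOn_pow_mul_fW {m : ℕ} (hm : 0 < m) (k : ℕ) :
    IntegrableOn (fun w => w ^ k * fW m w) (Ioi 0) := by
  have hm' : (0 : ℝ) < m := Nat.cast_pos.2 hm
  have h := (integrableOn_rpow_mul_exp_neg_mul_sq (b := (m : ℝ) / 2) (half_pos hm')
    (s := (m : ℝ) - 1 + k) (by have : (0 : ℝ) ≤ k := k.cast_nonneg
                               linarith)).const_mul
    (2 * ((m : ℝ) / 2) ^ ((m : ℝ) / 2) / Real.Gamma ((m : ℝ) / 2))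
  refine IntegrableOn.congr_fun h (fun w hw => ?_) measurableSet_Ioi
  have hw' : 0 < w := hw
  simp only [fW, if_pos hw', Real.rpow_add hw', Real.rpow_natCast]
  rw [show -(m : ℝ) * w ^ 2 / 2 = -((m : ℝ) / 2) * w ^ 2 by ring]
  ring

lemma integrableOn_phi_mul {m : ℕ} (hm : 0 < m) (t : ℝ) :
    IntegrableOn (fun w => phi (t * w) * (w ^ 2 * fW m w)) (Ioi 0) :=
  (integrableOn_pow_mul_fW hm 2).bdd_mul (c := phi 0)
    (continuous_phi.comp (continuous_const_mul t)).aestronglyMeasurable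
    (Filter.Eventually.of_forall fun w => by
      rw [Real.norm_of_nonneg (phi_pos _).le]
      exact phi_le_phi_zero _)

lemma integrableOn_Phi_mul {m : ℕ} (hm : 0 < m) (s : ℝ) :
    IntegrableOn (fun w => Phi (s * w) * (w * fW m w)) (Ioi 0) := by
  have h := integrableOn_pow_mul_fW hm 1
  simp only [pow_one] at h
  exact h.bdd_mul (c := ∫ u, phi u)
    (continuous_Phi.comp (continuous_const_mul s)).aestronglyMeasurable
    (Filter.Eventually.of_forall fun w => abs_Phi_le _)

/-- `r` attains its global minimum on `(0,∞)` uniquely at `s = t`. -/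
theorem rfun_min_unique_at_t
    (m : ℕ) (hm : 0 < m) (t : ℝ) (ht : 0 < t) :
    ∀ s : ℝ, 0 < s → s ≠ t → rfun m t t < rfun m t s := by
  intro s hs hst
  set A := fun w => phi (t * w) * (w ^ 2 * fW m w)
  set B := fun (s w : ℝ) => Phi (s * w) * (w * fW m w)
  have hA : IntegrableOn A (Ioi 0) := integrableOn_phi_mul hm t
  have hB (s : ℝ) : IntegrableOn (B s) (Ioi 0) := integrableOn_Phi_mul hm s
  have hBB : IntegrableOn (fun w => B s w - B t w) (Ioi 0) := (hB s).sub (hB t)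
  have hAs : IntegrableOn (fun w => A w * (s - t)) (Ioi 0) := hA.mul_const _
  have hpos : ∀ w ∈ Ioi (0 : ℝ), 0 < A w * (s - t) - (B s w - B t w) := by
    intro w (hw : 0 < w)
    have h := Phi_sub_Phi_lt (mul_pos ht hw) (mul_pos hs hw)
      (fun h => hst (mul_right_cancel₀ hw.ne' h))
    have := mul_lt_mul_of_pos_right h (mul_pos hw (fW_pos hm hw))
    simp only [A, B]
    linarith
  have hint : 0 < ∫ w in Ioi (0 : ℝ), (A w * (s - t) - (B s w - B t w)) := by
    rw [setIntegral_pos_iff_support_of_nonneg_ae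
      (ae_restrict_of_forall_mem measurableSet_Ioi fun w hw => (hpos w hw).le) (hAs.sub hBB)]
    rw [inter_eq_right.2 fun w hw => Function.mem_support.2 (hpos w hw).ne', Real.volume_Ioi]
    exact ENNReal.zero_lt_top
  rw [integral_sub hAs hBB, integral_mul_const, integral_sub (hB s) (hB t)] at hint
  have hr (u : ℝ) : rfun m t u = (2 * ∫ w in Ioi (0 : ℝ), A w) * u -
      2 * ∫ w in Ioi (0 : ℝ), B u w := rfl
  rw [hr, hr]
  linarith
end
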